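/- Let S = (ℤ/2ℤ)[x₁,…,x₁₀]/J, where J is the ideal generated by x₁², x_j² − x_j·x_{j−1} for j = 2,…,9, and x₁₀² − x₁₀·(x₁+⋯+x₈); set y₁ = 0, y_j = x_{j−1} for j = 2,…,9, and y₁₀ = x₁+⋯+x₈ in S, and let w₃ = Σ_{1 ≤ i < j < k ≤ 10} y_i·y_j·y_k. Then w₃² ≠ 0 in S. -/

import Mathlib

noncomputable section

/-- The generator `xⱼ` (paper-indexed, `j ∈ {1, …, 10}`) of the polynomial ring
`(ℤ/2ℤ)[x₁, …, x₁₀]`. -/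
def Xv (j : ℕ) : MvPolynomial (Fin 10) (ZMod 2) :=
  if h : 1 ≤ j ∧ j ≤ 10 then MvPolynomial.X ⟨j - 1, by omega⟩ else 0

/-- The ideal `J` of `(ℤ/2ℤ)[x₁, …, x₁₀]` generated by `x₁²`, `xⱼ² − xⱼ·xⱼ₋₁` for
`j = 2, …, 9`, and `x₁₀² − x₁₀·(x₁ + ⋯ + x₈)`. -/
def bottIdeal : Ideal (MvPolynomial (Fin 10) (ZMod 2)) :=
  Ideal.span
    ({Xv 1 ^ 2, Xv 10 ^ 2 - Xv 10 * (∑ l ∈ Finset.Icc 1 8, Xv l)} ∪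
      {p | ∃ j : ℕ, 2 ≤ j ∧ j ≤ 9 ∧ p = Xv j ^ 2 - Xv j * Xv (j - 1)})

/-- The image of `xⱼ` in the quotient ring `S = (ℤ/2ℤ)[x₁, …, x₁₀]/J`, the mod-2 cohomology
ring of the 10-dimensional real Bott manifold `Y(A)`. -/
def xq (j : ℕ) : MvPolynomial (Fin 10) (ZMod 2) ⧸ bottIdeal :=
  Ideal.Quotient.mk bottIdeal (Xv j)

/-- The classes `yⱼ` in `S`: `y₁ = 0`, `yⱼ = xⱼ₋₁` for `j = 2, …, 9`, and
`y₁₀ = x₁ + ⋯ + x₈`. -/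
def yq (j : ℕ) : MvPolynomial (Fin 10) (ZMod 2) ⧸ bottIdeal :=
  if j = 10 then ∑ l ∈ Finset.Icc 1 8, xq l
  else if 2 ≤ j ∧ j ≤ 9 then xq (j - 1) else 0

/-- The third elementary symmetric sum of `y 1, …, y 10` when `y 1 = y 4 = y 9 = 0`. -/
lemma sum_triple_products {R : Type*} [CommRing R] (y : ℕ → R) (h₁ : y 1 = 0) (h₄ : y 4 = 0)
    (h₉ : y 9 = 0) :
    ∑ i ∈ Finset.Icc 1 10, ∑ j ∈ Finset.Icc (i + 1) 10, ∑ k ∈ Finset.Icc (j + 1) 10,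
        y i * y j * y k =
      y 2 * y 3 * (y 5 + y 6 + y 7 + y 8 + y 10) + (y 2 + y 3) * y 5 * (y 6 + y 7 + y 8 + y 10) +
        (y 2 + y 3 + y 5) * y 6 * (y 7 + y 8 + y 10) +
        (y 2 + y 3 + y 5 + y 6) * y 7 * (y 8 + y 10) +
        (y 2 + y 3 + y 5 + y 6 + y 7) * y 8 * y 10 := by
  simp [Finset.sum_Icc_succ_top, h₁, h₄, h₉]
  ring

/-- Adjoining a root of `X² - a X` to an algebra keeps multiples of the new element by nonzero
elements of the base nonzero. -/
lemma exists_quadratic_extension {A : Type} [CommRing A] [Algebra (ZMod 2) A] (a m : A)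
    (hm : m ≠ 0) :
    ∃ (B : Type) (_ : CommRing B) (_ : Algebra (ZMod 2) B) (f : A →ₐ[ZMod 2] B) (x : B),
      x ^ 2 = x * f a ∧ f m * x ≠ 0 := by
  refine ⟨QuadraticAlgebra A 0 a, inferInstance, inferInstance,
    (Algebra.ofId A (QuadraticAlgebra A 0 a)).restrictScalars (ZMod 2), ⟨0, 1⟩, ?_, ?_⟩
  · ext <;> simp [pow_two, Algebra.ofId_apply]
  · intro h
    exact hm (by simpa [Algebra.ofId_apply] using congrArg QuadraticAlgebra.im h)

/-- The cohomology ring of a product of two real Bott manifolds of dimensions `2` and `4`, each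
with matrix having ones exactly on the superdiagonal, with its nonzero top class. -/
lemma exists_bott_tower :
    ∃ (T : Type) (_ : CommRing T) (_ : Algebra (ZMod 2) T) (a b c d e f : T),
      a ^ 2 = 0 ∧ b ^ 2 = b * a ∧ c ^ 2 = 0 ∧ d ^ 2 = d * c ∧ e ^ 2 = e * d ∧ f ^ 2 = f * e ∧
        a * b * c * d * e * f ≠ 0 := by
  obtain ⟨A, _, _, g₁, a, ha, hm⟩ := exists_quadratic_extension (0 : ZMod 2) 1 one_ne_zero
  rw [map_zero, mul_zero] at ha
  rw [map_one, one_mul] at hm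
  obtain ⟨B, _, _, g₂, b, hb, hm⟩ := exists_quadratic_extension a a hm
  obtain ⟨C, _, _, g₃, c, hc, hm⟩ := exists_quadratic_extension 0 _ hm
  rw [map_zero, mul_zero] at hc
  obtain ⟨D, _, _, g₄, d, hd, hm⟩ := exists_quadratic_extension c _ hm
  obtain ⟨E, _, _, g₅, e, he, hm⟩ := exists_quadratic_extension d _ hm
  obtain ⟨F, _, _, g₆, f, hf, hm⟩ := exists_quadratic_extension e _ hm
  refine ⟨F, inferInstance, inferInstance, g₆ (g₅ (g₄ (g₃ (g₂ a)))), g₆ (g₅ (g₄ (g₃ b))),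
    g₆ (g₅ (g₄ c)), g₆ (g₅ d), g₆ e, f, ?_, ?_, ?_, ?_, ?_, hf, by simpa using hm⟩
  · simp [← map_pow, ha]
  · simp [← map_pow, hb]
  · simp [← map_pow, hc]
  · simp [← map_pow, hd]
  · simp [← map_pow, he]

/-- The generators of `bottIdeal` vanish under a point satisfying the relations of the tower. -/
lemma bottIdeal_le_ker {T : Type} [CommRing T] [Algebra (ZMod 2) T] {a b c d e f : T}
    (ha : a ^ 2 = 0) (hb : b ^ 2 = b * a) (hc : c ^ 2 = 0) (hd : d ^ 2 = d * c)
    (he : e ^ 2 = e * d) (hf : f ^ 2 = f * e) :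
    bottIdeal ≤ RingHom.ker (MvPolynomial.aeval (R := ZMod 2) ![a, b, 0, c, d, e, f, 0, 0, 0]) := by
  refine Ideal.span_le.2 ?_
  rintro p ((rfl | rfl) | ⟨j, hj, hj', rfl⟩)
  · simp [Xv, ha]
  · simp [Xv]
  · interval_cases j <;> simp [Xv, *]

/-- In the ring `S = (ℤ/2ℤ)[x₁,…,x₁₀]/J`, with
`w₃ = Σ_{1 ≤ i < j < k ≤ 10} yᵢ·yⱼ·y_k` (the third Stiefel–Whitney class of the
10-dimensional real Bott manifold `Y(A)`), one has `w₃² ≠ 0`. -/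
theorem stmt15 :
    (∑ i ∈ Finset.Icc 1 10, ∑ j ∈ Finset.Icc (i + 1) 10, ∑ k ∈ Finset.Icc (j + 1) 10,
        yq i * yq j * yq k) ^ 2 ≠ 0 := by
  obtain ⟨T, _, _, a, b, c, d, e, f, ha, hb, hc, hd, he, hf, htop⟩ := exists_bott_tower
  let φ := Ideal.Quotient.lift bottIdeal _ (bottIdeal_le_ker ha hb hc hd he hf)
  have φ_xq (j : ℕ) : φ (xq j) =
      MvPolynomial.aeval (R := ZMod 2) ![a, b, 0, c, d, e, f, 0, 0, 0] (Xv j) :=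
    Ideal.Quotient.lift_mk _ _ _
  have : CharP T 2 := by
    have : Nontrivial T := ⟨_, _, htop⟩
    exact charP_of_injective_algebraMap (algebraMap (ZMod 2) T).injective 2
  have hs : ∑ l ∈ Finset.Icc 1 8, φ (xq l) = a + b + c + d + e + f := by
    simp [Finset.sum_Icc_succ_top, φ_xq, Xv]
  intro h
  apply htop
  have h' := congrArg φ h
  simp only [map_pow, map_sum, map_mul, map_zero] at h'
  rw [sum_triple_products (fun j => φ (yq j)) (by simp [yq]) (by simp [yq, φ_xq, Xv])
    (by simp [yq, φ_xq, Xv])] at h'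
  have hy (j : ℕ) (hj : 2 ≤ j ∧ j ≤ 9) : φ (yq j) = φ (xq (j - 1)) := by
    rw [yq, if_neg (by omega), if_pos hj]
  have hy' : φ (yq 10) = a + b + c + d + e + f := by
    rw [yq, if_pos rfl, map_sum, hs]
  simp only [hy 2 (by omega), hy 3 (by omega), hy 5 (by omega), hy 6 (by omega), hy 7 (by omega),
    hy 8 (by omega), hy'] at h'
  simp [φ_xq, Xv] at h'
  simp only [CharTwo.add_sq, mul_pow, ha, hb, hc, hd, he, hf, zero_mul, mul_zero, zero_add, add_zero] at h'
  have hp : (b * a) ^ 2 = 0 := by rw [mul_pow, ha, mul_zero]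
  have hq : (d * c) ^ 2 = 0 := by rw [mul_pow, hc, mul_zero]
  have hr : (e * d) ^ 2 = 0 := by
    linear_combination d ^ 2 * he + (e * d + e * c) * hd + e * d * hc
  have ht : (f * e) ^ 2 = c * d * e * f := by
    linear_combination e ^ 2 * hf + (f * e + f * d) * he + f * e * hd
  linear_combination h' - (d * c + e * d + f * e) * hp - (b * a + e * d + f * e + e * f) * hq -
    (b * a + d * c + f * e + c * f) * hr - (b * a + d * c + e * d) * ht -
    2 * (b * a * (d * c) * (e * d) + b * a * (d * c) * (f * e) + b * a * (e * d) * (f * e) +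
      d * c * (e * d) * (f * e)) * CharTwo.two_eq_zero (R := T)

end
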